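/- arXiv:2005.04533 — 2 statements merged into one kernel-verified Lean document; each statement's English description precedes it below -/
import Mathlib

section
/- Let m \ge 9 be a natural number and b \ge 1 a real number, and set 1 + \delta = 3 b \ln m / \ln \ln m (so \delta = 3 b \ln m / \ln \ln m - 1). Then \delta - (1+\delta) \ln(1+\delta) \le -1.5 b \ln m - 3 b (\ln b) (\ln m / \ln \ln m) - 1. -/
/-- For `m ≥ 9` and real `b ≥ 1`, setting `1 + δ = 3 b ln m / ln ln m`, one has
`δ - (1+δ) ln (1+δ) ≤ -1.5 b ln m - 3 b (ln b) (ln m / ln ln m) - 1`. -/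
theorem chernoff_exponent_estimate (m : ℕ) (hm : 9 ≤ m) (b : ℝ) (hb : 1 ≤ b)
    (δ : ℝ) (hδ : 1 + δ = 3 * b * Real.log m / Real.log (Real.log m)) :
    δ - (1 + δ) * Real.log (1 + δ)
      ≤ -(1.5 * b * Real.log m)
          - 3 * b * Real.log b * (Real.log m / Real.log (Real.log m)) - 1 := by
  have hm' : (9 : ℝ) ≤ m := by exact_mod_cast hm
  have hL : 1 < Real.log m := by
    rw [Real.lt_log_iff_exp_lt (by linarith)]
    linarith [Real.exp_one_lt_d9]
  have hy : 0 < Real.log (Real.log m) := Real.log_pos hL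
  generalize Real.log (m : ℝ) = L at *
  have hlog : Real.log (1 + δ)
      = Real.log 3 + Real.log b + Real.log L - Real.log (Real.log L) := by
    rw [hδ, Real.log_div (by positivity) hy.ne', Real.log_mul (by positivity) (by positivity),
      Real.log_mul (by norm_num) (by positivity)]
  have hX : 0 < 1 + δ := by rw [hδ]; positivity
  have h1 : Real.log (Real.log L / 2) ≤ Real.log L / 2 - 1 :=
    Real.log_le_sub_one_of_pos (by positivity)
  rw [Real.log_div hy.ne' (by norm_num)] at h1
  have h2 : Real.log 2 ≤ Real.log 3 := Real.log_le_log (by norm_num) (by norm_num)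
  rw [hlog]
  have e1 : 1.5 * b * L = (1 + δ) * (Real.log L / 2) := by
    rw [hδ]; field_simp; norm_num
  have e2 : 3 * b * Real.log b * (L / Real.log L) = (1 + δ) * Real.log b := by
    rw [hδ]; ring
  rw [e1, e2]
  have h3 : 0 ≤ (1 + δ) * (Real.log 3 + Real.log L / 2 - Real.log (Real.log L) - 1) :=
    mul_nonneg hX.le (by linarith)
  linarith
end

section
/- Let X be a real random variable with X \in [0,1] almost surely and expectation \mu = E[X]. Then for every real \theta, E[exp(\theta X)] \le exp((exp(\theta) - 1) \cdot \mu). -/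
open MeasureTheory ProbabilityTheory

/-- For a real random variable `X ∈ [0,1]` a.s. with `μ = E[X]`, for every real `θ`,
`E[exp (θ X)] ≤ exp ((exp θ - 1) μ)`. -/
theorem mgf_le_exp_of_mem_Icc
    {Ω : Type*} [MeasureSpace Ω] [IsProbabilityMeasure (ℙ : Measure Ω)]
    (X : Ω → ℝ) (hXmeas : Measurable X)
    (hXval : ∀ᵐ ω ∂ℙ, X ω ∈ Set.Icc (0 : ℝ) 1)
    (μ : ℝ) (hμ : μ = ∫ ω, X ω ∂ℙ) (θ : ℝ) :
    (∫ ω, Real.exp (θ * X ω) ∂ℙ) ≤ Real.exp ((Real.exp θ - 1) * μ) := by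
  have hX : Integrable X (ℙ : Measure Ω) := by
    refine Integrable.of_bound hXmeas.aestronglyMeasurable 1 ?_
    filter_upwards [hXval] with ω h
    rw [Real.norm_eq_abs, abs_of_nonneg h.1]
    exact h.2
  have hpt : ∀ᵐ ω ∂(ℙ : Measure Ω), Real.exp (θ * X ω) ≤ 1 + (Real.exp θ - 1) * X ω := by
    filter_upwards [hXval] with ω h
    have hc := convexOn_exp.2 (Set.mem_univ (0 : ℝ)) (Set.mem_univ θ)
      (sub_nonneg.2 h.2) h.1 (by ring)
    simp only [smul_eq_mul, mul_zero, zero_add, Real.exp_zero, mul_one] at hc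
    rw [mul_comm θ]
    linarith
  have hg : Integrable (fun ω => 1 + (Real.exp θ - 1) * X ω) (ℙ : Measure Ω) :=
    (integrable_const 1).add (hX.const_mul _)
  have h1 : (∫ ω, Real.exp (θ * X ω) ∂ℙ) ≤ ∫ ω, (1 + (Real.exp θ - 1) * X ω) ∂ℙ :=
    integral_mono_of_nonneg (Filter.Eventually.of_forall fun ω => (Real.exp_pos _).le) hg hpt
  rw [integral_add (integrable_const 1) (hX.const_mul _), integral_const_mul, ← hμ] at h1
  simp only [integral_const, probReal_univ, smul_eq_mul, mul_one] at h1
  linarith [Real.add_one_le_exp ((Real.exp θ - 1) * μ)]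
end
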